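/- Fix a weight matrix P ∈ ℝ_{>0}^{m×n} and let f : ℝ_{>0}^m → ℝ_{>0} be monotone and homogeneous. (a) Maximization: suppose X* is a feasible assignment with strictly positive loads such that f(ℓ(P,X*)) ≥ f(ℓ(P,X)) for every feasible assignment X with strictly positive loads. Then for every ε > 0 there exist α ∈ ℝ and w ∈ ℝ_{>0}^m such that f(ℓ(P,α,w)) ≥ (1−ε)·f(ℓ(P,X*)). (b) Minimization: suppose X* is a feasible assignment with strictly positive loads such that f(ℓ(P,X*)) ≤ f(ℓ(P,X)) for every feasible assignment X with strictly positive loads. Then for every ε > 0 there exist α ∈ ℝ and w ∈ ℝ_{>0}^m such that f(ℓ(P,α,w)) ≤ (1+ε)·f(ℓ(P,X*)). -/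

import Mathlib

open Finset

/-- EP-allocation with exponent `α`: fraction of item `j` assigned to agent `i`. -/
noncomputable def epAlloc {m n : ℕ} (P : Fin m → Fin n → ℝ) (α : ℝ) (w : Fin m → ℝ)
    (i : Fin m) (j : Fin n) : ℝ :=
  P i j ^ α * w i / ∑ i', P i' j ^ α * w i'

/-- Load of agent `i` under the EP-allocation with exponent `α`. -/
noncomputable def epLoad {m n : ℕ} (P : Fin m → Fin n → ℝ) (α : ℝ) (w : Fin m → ℝ)
    (i : Fin m) : ℝ :=
  ∑ j, epAlloc P α w i j * P i j

/-- A feasible (fractional) assignment: entries in `[0,1]`, each item fully allocated. -/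
def Feasible {m n : ℕ} (X : Fin m → Fin n → ℝ) : Prop :=
  (∀ i j, 0 ≤ X i j ∧ X i j ≤ 1) ∧ ∀ j, ∑ i, X i j = 1

/-- Load of agent `i` under the assignment `X`. -/
noncomputable def loadX {m n : ℕ} (P X : Fin m → Fin n → ℝ) (i : Fin m) : ℝ :=
  ∑ j, X i j * P i j

/-- Optimal makespan (MinMax objective). -/
noncomputable def MKS {m n : ℕ} (P : Fin m → Fin n → ℝ) : ℝ :=
  sInf { t | ∃ X, Feasible X ∧ t = ⨆ i, loadX P X i }

/-- Optimal Santa Claus value (MaxMin objective). -/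
noncomputable def SNT {m n : ℕ} (P : Fin m → Fin n → ℝ) : ℝ :=
  sSup { t | ∃ X, Feasible X ∧ t = ⨅ i, loadX P X i }

open Filter Topology

noncomputable def auxG {m n : ℕ} (a b : Fin m → Fin n → ℝ) (w : Fin m → ℝ) (i : Fin m) : ℝ :=
  ∑ j, a i j * w i / (∑ k, a k j * w k) * b i j

lemma auxG_den_pos {m n : ℕ} (a : Fin m → Fin n → ℝ) (ha : ∀ i j, 0 < a i j)
    (w : Fin m → ℝ) (hw : ∀ i, 0 < w i) (i : Fin m) (j : Fin n) : 0 < ∑ k, a k j * w k :=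
  Finset.sum_pos (fun k _ => mul_pos (ha k j) (hw k)) ⟨i, Finset.mem_univ i⟩

lemma auxG_pos {m n : ℕ} (hn : 0 < n) (a b : Fin m → Fin n → ℝ) (ha : ∀ i j, 0 < a i j)
    (hb : ∀ i j, 0 < b i j) (w : Fin m → ℝ) (hw : ∀ i, 0 < w i) (i : Fin m) :
    0 < auxG a b w i := by
  refine Finset.sum_pos (fun j _ => ?_) ⟨⟨0, hn⟩, Finset.mem_univ _⟩
  exact mul_pos (div_pos (mul_pos (ha i j) (hw i)) (auxG_den_pos a ha w hw i j)) (hb i j)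

lemma auxG_scale {m n : ℕ} (a b : Fin m → Fin n → ℝ) (w : Fin m → ℝ) (c : ℝ) (hc : 0 < c) :
    auxG a b (fun i => w i / c) = auxG a b w := by
  funext i
  unfold auxG
  refine Finset.sum_congr rfl fun j _ => ?_
  have : ∑ k, a k j * (w k / c) = (∑ k, a k j * w k) / c := by
    rw [Finset.sum_div]; exact Finset.sum_congr rfl fun k _ => by ring
  rw [this, ← mul_div_assoc, div_div_div_cancel_right₀ hc.ne']

lemma auxG_le {m n : ℕ} (a b : Fin m → Fin n → ℝ) (ha : ∀ i j, 0 < a i j)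
    (hb : ∀ i j, 0 < b i j) (w : Fin m → ℝ) (hw : ∀ i, 0 < w i) (i k : Fin m) :
    auxG a b w i ≤ (∑ i, ∑ k, ∑ j, a i j / a k j * b i j) * (w i / w k) := by
  have hnn : ∀ i k j, 0 ≤ a i j / a k j * b i j := fun i k j =>
    (mul_pos (div_pos (ha i j) (ha k j)) (hb i j)).le
  have h1 : ∑ j, a i j / a k j * b i j ≤ ∑ i, ∑ k, ∑ j, a i j / a k j * b i j := by
    refine le_trans ?_ (Finset.single_le_sum (f := fun i => ∑ k, ∑ j, a i j / a k j * b i j)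
      (fun i _ => Finset.sum_nonneg fun k _ => Finset.sum_nonneg fun j _ => hnn i k j)
      (Finset.mem_univ i))
    exact Finset.single_le_sum (f := fun k => ∑ j, a i j / a k j * b i j)
      (fun k _ => Finset.sum_nonneg fun j _ => hnn i k j) (Finset.mem_univ k)
  refine le_trans ?_ (mul_le_mul_of_nonneg_right h1 (div_pos (hw i) (hw k)).le)
  unfold auxG
  rw [Finset.sum_mul]
  refine Finset.sum_le_sum fun j _ => ?_
  have h2 : a k j * w k ≤ ∑ k, a k j * w k :=
    Finset.single_le_sum (f := fun k => a k j * w k)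
      (fun k _ => (mul_pos (ha k j) (hw k)).le) (Finset.mem_univ k)
  have h3 : a i j * w i / (∑ k, a k j * w k) ≤ a i j * w i / (a k j * w k) :=
    div_le_div_of_nonneg_left (mul_pos (ha i j) (hw i)).le (mul_pos (ha k j) (hw k)) h2
  calc _ ≤ a i j * w i / (a k j * w k) * b i j := mul_le_mul_of_nonneg_right h3 (hb i j).le
    _ = _ := by rw [mul_div_mul_comm]; ring

lemma auxG_cont {m n : ℕ} (a b : Fin m → Fin n → ℝ) (ha : ∀ i j, 0 < a i j)
    (w : Fin m → ℝ) (hw : ∀ i, 0 < w i) (i : Fin m) :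
    ContinuousAt (fun w => auxG a b w i) w := by
  unfold auxG
  refine tendsto_finsetSum _ fun j _ => ?_
  have : ContinuousAt (fun w : Fin m → ℝ => a i j * w i / (∑ k, a k j * w k) * b i j) w := by
    refine ContinuousAt.mul (ContinuousAt.div ?_ ?_ (auxG_den_pos a ha w hw i j).ne')
      continuousAt_const
    · exact (continuous_const.mul (continuous_apply i)).continuousAt
    · exact (continuous_finsetSum _ fun k _ =>
        continuous_const.mul (continuous_apply k)).continuousAt
  exact this

lemma auxG_exists_max {m n : ℕ} (hm : 0 < m) (hn : 0 < n) (a b : Fin m → Fin n → ℝ)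
    (ha : ∀ i j, 0 < a i j) (hb : ∀ i j, 0 < b i j) :
    ∃ (w : Fin m → ℝ) (L : ℝ), (∀ i, 0 < w i) ∧ (∀ i, L ≤ auxG a b w i) ∧
      ∀ v : Fin m → ℝ, (∀ i, 0 < v i) → ∃ i, auxG a b v i ≤ L := by
  have hne : (Finset.univ : Finset (Fin m)).Nonempty := ⟨⟨0, hm⟩, Finset.mem_univ _⟩
  set h : (Fin m → ℝ) → ℝ := fun w => Finset.univ.inf' hne (fun i => auxG a b w i) with hh
  set C : ℝ := ∑ i, ∑ k, ∑ j, a i j / a k j * b i j with hC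
  have hle : ∀ w i, h w ≤ auxG a b w i := fun w i =>
    Finset.inf'_le (fun i => auxG a b w i) (Finset.mem_univ i)
  have hex : ∀ w, ∃ i, h w = auxG a b w i := fun w => by
    obtain ⟨i, _, hi⟩ := Finset.exists_mem_eq_inf' hne (fun i => auxG a b w i)
    exact ⟨i, hi⟩
  set c := h (fun _ => 1) with hc
  have hcpos : 0 < c := by
    obtain ⟨i, hi⟩ := hex (fun _ => 1)
    rw [hc, hi]
    exact auxG_pos hn a b ha hb _ (fun _ => one_pos) i
  have hcC : c ≤ C := by
    have := auxG_le a b ha hb (fun _ => 1) (fun _ => one_pos) ⟨0, hm⟩ ⟨0, hm⟩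
    simp only [div_one, mul_one] at this
    exact (hle _ _).trans this
  have hCpos : 0 < C := hcpos.trans_le hcC
  have hδ : 0 < c / C := div_pos hcpos hCpos
  have hδ1 : c / C ≤ 1 := (div_le_one hCpos).2 hcC
  set K : Set (Fin m → ℝ) := Set.pi Set.univ (fun _ => Set.Icc (c / C) 1) with hK
  have hKc : IsCompact K := isCompact_univ_pi fun _ => isCompact_Icc
  have h1K : (fun _ => 1 : Fin m → ℝ) ∈ K := fun i _ => ⟨hδ1, le_rfl⟩
  have hKpos : ∀ w ∈ K, ∀ i, 0 < w i := fun w hw i => hδ.trans_le (hw i trivial).1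
  have hcont : ContinuousOn h K := by
    intro w hw
    refine ContinuousAt.continuousWithinAt ?_
    exact ContinuousAt.finset_inf'_apply hne fun i _ => auxG_cont a b ha w (hKpos w hw) i
  obtain ⟨w0, hw0, hmax⟩ := hKc.exists_isMaxOn ⟨_, h1K⟩ hcont
  refine ⟨w0, h w0, hKpos w0 hw0, hle w0, fun v hv => ?_⟩
  by_contra! hcon
  obtain ⟨k, _, hk⟩ := Finset.exists_max_image Finset.univ v hne
  have hvK : (fun i => v i / v k) ∈ K := by
    intro i _
    refine ⟨?_, (div_le_one (hv k)).2 (hk i (Finset.mem_univ i))⟩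
    rw [div_le_iff₀ hCpos, mul_comm]
    exact ((hmax h1K).trans (hcon i).le).trans (auxG_le a b ha hb v hv i k)
  have h2 : h (fun i => v i / v k) ≤ h w0 := hmax hvK
  obtain ⟨i, hi⟩ := hex (fun i => v i / v k)
  rw [hi, auxG_scale a b v (v k) (hv k)] at h2
  exact absurd (hcon i) (not_lt.2 h2)

lemma auxG_exists_eq {m n : ℕ} (hm : 0 < m) (hn : 0 < n) (a b : Fin m → Fin n → ℝ)
    (ha : ∀ i j, 0 < a i j) (hb : ∀ i j, 0 < b i j) :
    ∃ (w : Fin m → ℝ) (L : ℝ), (∀ i, 0 < w i) ∧ ∀ i, auxG a b w i = L := by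
  classical
  obtain ⟨w, L, hw, hL, hmax⟩ := auxG_exists_max hm hn a b ha hb
  refine ⟨w, L, hw, ?_⟩
  by_contra! hcon
  obtain ⟨i0, hi0⟩ := hcon
  set W : ℝ → Fin m → ℝ := fun t i => if auxG a b w i = L then t * w i else w i with hW
  have hW1 : W 1 = w := by funext i; simp [hW]
  have hWpos : ∀ t, 0 < t → ∀ i, 0 < W t i := by
    intro t ht i
    simp only [hW]
    split_ifs
    · exact mul_pos ht (hw i)
    · exact hw i
  have hWc : Continuous W := by
    refine continuous_pi fun i => ?_
    simp only [hW]
    split_ifs <;> fun_prop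
  have hev : ∀ᶠ t in 𝓝 (1:ℝ), ∀ i, auxG a b w i ≠ L → L < auxG a b (W t) i := by
    rw [Filter.eventually_all]
    intro i
    by_cases hi : auxG a b w i = L
    · simp [hi]
    · have h1 : ContinuousAt (fun v => auxG a b v i) (W 1) := by
        rw [hW1]; exact auxG_cont a b ha w hw i
      have h2 : ContinuousAt (fun t => auxG a b (W t) i) 1 :=
        ContinuousAt.comp (f := W) h1 hWc.continuousAt
      have h3 : L < auxG a b (W 1) i := by
        rw [hW1]; exact lt_of_le_of_ne (hL i) (Ne.symm hi)
      filter_upwards [h2.eventually (lt_mem_nhds h3)] with t ht _ using ht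
  have hev2 : ∀ᶠ t in 𝓝[>] (1:ℝ), (∀ i, auxG a b w i ≠ L → L < auxG a b (W t) i) ∧ 1 < t :=
    (hev.filter_mono nhdsWithin_le_nhds).and self_mem_nhdsWithin
  obtain ⟨t, ht, ht1⟩ := hev2.exists
  have ht0 : 0 < t := one_pos.trans ht1
  obtain ⟨i, hi⟩ := hmax (W t) (hWpos t ht0)
  by_cases hiL : auxG a b w i = L
  · rw [← hiL] at hi
    refine absurd hi (not_le.2 ?_)
    unfold auxG
    refine Finset.sum_lt_sum_of_nonempty ⟨⟨0, hn⟩, Finset.mem_univ _⟩ fun j _ => ?_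
    refine mul_lt_mul_of_pos_right ?_ (hb i j)
    have hWi : W t i = t * w i := by simp only [hW, if_pos hiL]
    have hd := auxG_den_pos a ha w hw i j
    have hd' := auxG_den_pos a ha (W t) (hWpos t ht0) i j
    have hlt : ∑ k, a k j * W t k < t * ∑ k, a k j * w k := by
      rw [Finset.mul_sum]
      refine Finset.sum_lt_sum (fun k _ => ?_) ⟨i0, Finset.mem_univ _, ?_⟩
      · have := mul_pos (ha k j) (hw k)
        simp only [hW]
        split_ifs
        · exact le_of_eq (by ring)
        · nlinarith
      · have := mul_pos (ha i0 j) (hw i0)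
        simp only [hW, if_neg hi0]
        nlinarith
    rw [div_lt_div_iff₀ hd hd', hWi]
    have := mul_pos (ha i j) (hw i)
    nlinarith
  · exact absurd hi (not_le.2 (ht i hiL))

lemma ep_exists {m n : ℕ} (hm : 0 < m) (hn : 0 < n) (P : Fin m → Fin n → ℝ)
    (hP : ∀ i j, 0 < P i j) (ℓ : Fin m → ℝ) (hℓ : ∀ i, 0 < ℓ i) (α : ℝ) :
    ∃ (w : Fin m → ℝ) (L : ℝ), (∀ i, 0 < w i) ∧ 0 < L ∧
      epLoad P α w = fun i => L * ℓ i := by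
  have ha : ∀ i j, 0 < P i j ^ α := fun i j => Real.rpow_pos_of_pos (hP i j) α
  have hb : ∀ i j, 0 < P i j / ℓ i := fun i j => div_pos (hP i j) (hℓ i)
  obtain ⟨w, L, hw, hL⟩ := auxG_exists_eq hm hn (fun i j => P i j ^ α)
    (fun i j => P i j / ℓ i) ha hb
  refine ⟨w, L, hw, ?_, ?_⟩
  · rw [← hL ⟨0, hm⟩]
    exact auxG_pos hn _ _ ha hb w hw _
  · funext i
    rw [← hL i]
    unfold auxG epLoad epAlloc
    rw [Finset.sum_mul]
    refine Finset.sum_congr rfl fun j _ => ?_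
    have := (hℓ i).ne'
    field_simp

lemma avg_ge {m : ℕ} (ε α : ℝ) (hε : 0 < ε) (hε1 : ε < 1) (hα : 0 < α)
    (h : m * (1 - ε) ^ α ≤ ε) (q : Fin m → ℝ) (hq : ∀ i, 0 < q i) (k : Fin m)
    (hk : ∀ i, q i ≤ q k) :
    (1 - ε) * q k * ∑ i, q i ^ α ≤ ∑ i, q i ^ α * q i := by
  have hc : 0 < 1 - ε := by linarith
  have hM := hq k
  have hcM := mul_pos hc hM
  have hMa := Real.rpow_pos_of_pos hM α
  have hca := Real.rpow_pos_of_pos hc α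
  have key : ∀ i, (if i = k then ε * (q k ^ α * q k) else 0) - (1 - ε) ^ α * (q k ^ α * q k) ≤
      q i ^ α * (q i - (1 - ε) * q k) := by
    intro i
    have hia := Real.rpow_pos_of_pos (hq i) α
    have hpos : 0 < (1 - ε) ^ α * (q k ^ α * q k) := by positivity
    split_ifs with hik
    · subst hik
      nlinarith
    · rcases le_total ((1 - ε) * q k) (q i) with h1 | h1
      · have := mul_nonneg hia.le (sub_nonneg.2 h1)
        linarith
      · have h2 : q i ^ α ≤ (1 - ε) ^ α * q k ^ α := by
          rw [← Real.mul_rpow hc.le hM.le]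
          exact Real.rpow_le_rpow (hq i).le h1 hα.le
        have h3 : (1 - ε) * q k - q i ≤ q k := by nlinarith [hq i]
        have h4 : q i ^ α * ((1 - ε) * q k - q i) ≤ ((1 - ε) ^ α * q k ^ α) * q k :=
          mul_le_mul h2 h3 (sub_nonneg.2 h1) (by positivity)
        linarith
  have hs := Finset.sum_le_sum fun i (_ : i ∈ Finset.univ) => key i
  rw [Finset.sum_sub_distrib] at hs
  simp only [Finset.sum_ite_eq', Finset.mem_univ, if_true, Finset.sum_const, Finset.card_univ,
    Fintype.card_fin, nsmul_eq_mul, mul_sub] at hs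
  rw [Finset.sum_sub_distrib, ← Finset.sum_mul] at hs
  have : 0 < q k ^ α * q k := by positivity
  nlinarith

lemma avg_le {m : ℕ} (ε β : ℝ) (hε : 0 < ε) (hβ : 1 ≤ β)
    (h : m * (1 + ε) ^ (1 - β) ≤ ε) (q : Fin m → ℝ) (hq : ∀ i, 0 < q i) (k : Fin m)
    (hk : ∀ i, q k ≤ q i) :
    ∑ i, q i ^ (-β) * q i ≤ (1 + ε) * q k * ∑ i, q i ^ (-β) := by
  have hc : 0 < 1 + ε := by linarith
  have hM := hq k
  have hcM := mul_pos hc hM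
  have hMa := Real.rpow_pos_of_pos hM (-β)
  have hca := Real.rpow_pos_of_pos hc (1 - β)
  have hadd : ∀ x : ℝ, 0 < x → x ^ (-β) * x = x ^ (1 - β) := by
    intro x hx
    rw [← Real.rpow_add_one hx.ne']
    congr 1; ring
  have key : ∀ i, q i ^ (-β) * (q i - (1 + ε) * q k) ≤
      (1 + ε) ^ (1 - β) * (q k ^ (-β) * q k) - (if i = k then ε * (q k ^ (-β) * q k) else 0) := by
    intro i
    have hia := Real.rpow_pos_of_pos (hq i) (-β)
    have hpos : 0 < (1 + ε) ^ (1 - β) * (q k ^ (-β) * q k) := by positivity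
    split_ifs with hik
    · subst hik
      nlinarith
    · rcases le_total (q i) ((1 + ε) * q k) with h1 | h1
      · have := mul_nonneg hia.le (sub_nonneg.2 h1)
        linarith
      · have h2 : q i ^ (1 - β) ≤ (1 + ε) ^ (1 - β) * q k ^ (1 - β) := by
          rw [← Real.mul_rpow hc.le hM.le]
          exact Real.rpow_le_rpow_of_nonpos hcM h1 (by linarith)
        rw [mul_sub, hadd _ (hq i), hadd _ hM]
        have := mul_pos hia hcM
        linarith
  have hs := Finset.sum_le_sum fun i (_ : i ∈ Finset.univ) => key i
  rw [Finset.sum_sub_distrib] at hs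
  simp only [Finset.sum_ite_eq', Finset.mem_univ, if_true, Finset.sum_const, Finset.card_univ,
    Fintype.card_fin, nsmul_eq_mul, mul_sub] at hs
  rw [Finset.sum_sub_distrib, ← Finset.sum_mul] at hs
  have : 0 < q k ^ (-β) * q k := by positivity
  nlinarith

lemma ep_alloc_eq {m n : ℕ} (P : Fin m → Fin n → ℝ) (hP : ∀ i j, 0 < P i j) (α : ℝ)
    (hα : α ≠ 0) (w : Fin m → ℝ) (hw : ∀ i, 0 < w i) (i : Fin m) (j : Fin n) :
    epAlloc P α w i j =
      (w i ^ α⁻¹ * P i j) ^ α / ∑ k, (w k ^ α⁻¹ * P k j) ^ α := by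
  have : ∀ k, (w k ^ α⁻¹ * P k j) ^ α = P k j ^ α * w k := by
    intro k
    rw [Real.mul_rpow (Real.rpow_pos_of_pos (hw k) _).le (hP k j).le,
      Real.rpow_inv_rpow (hw k).le hα, mul_comm]
  unfold epAlloc
  simp only [this]

lemma load_weighted {m n : ℕ} (P X : Fin m → Fin n → ℝ) (y : Fin m → ℝ) :
    ∑ i, loadX P X i * y i = ∑ j, ∑ i, X i j * (y i * P i j) := by
  unfold loadX
  rw [Finset.sum_comm]
  refine Finset.sum_congr rfl fun i _ => ?_
  rw [Finset.sum_mul]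
  exact Finset.sum_congr rfl fun j _ => by ring

/-- Maximization: the common ratio is almost at least one. -/
lemma ratio_ge {m n : ℕ} (hm : 0 < m) (P : Fin m → Fin n → ℝ)
    (hP : ∀ i j, 0 < P i j) (X : Fin m → Fin n → ℝ) (hX : Feasible X)
    (hl : ∀ i, 0 < loadX P X i) (ε α : ℝ) (hε : 0 < ε) (hε1 : ε < 1) (hα : 0 < α)
    (h : m * (1 - ε) ^ α ≤ ε) (w : Fin m → ℝ) (hw : ∀ i, 0 < w i) (L : ℝ)
    (hL : epLoad P α w = fun i => L * loadX P X i) : 1 - ε ≤ L := by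
  set y : Fin m → ℝ := fun i => w i ^ α⁻¹ with hy
  have hypos : ∀ i, 0 < y i := fun i => Real.rpow_pos_of_pos (hw i) _
  have hne : (Finset.univ : Finset (Fin m)).Nonempty := ⟨⟨0, hm⟩, Finset.mem_univ _⟩
  have hT : 0 < ∑ i, loadX P X i * y i := Finset.sum_pos (fun i _ => mul_pos (hl i) (hypos i)) hne
  have h1 : ∑ i, epLoad P α w i * y i = L * ∑ i, loadX P X i * y i := by
    rw [hL, Finset.mul_sum]
    exact Finset.sum_congr rfl fun i _ => by ring
  have h2 : (1 - ε) * ∑ i, loadX P X i * y i ≤ ∑ i, epLoad P α w i * y i := by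
    have e : ∑ i, epLoad P α w i * y i = ∑ j, ∑ i, epAlloc P α w i j * (y i * P i j) :=
      load_weighted P (epAlloc P α w) y
    rw [e, load_weighted, Finset.mul_sum]
    refine Finset.sum_le_sum fun j _ => ?_
    have hq : ∀ i, 0 < y i * P i j := fun i => mul_pos (hypos i) (hP i j)
    obtain ⟨k, _, hk⟩ := Finset.exists_max_image Finset.univ (fun i => y i * P i j) hne
    have hav := avg_ge ε α hε hε1 hα h (fun i => y i * P i j) hq k
      (fun i => hk i (Finset.mem_univ i))
    have hD : 0 < ∑ i, (y i * P i j) ^ α :=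
      Finset.sum_pos (fun i _ => Real.rpow_pos_of_pos (hq i) _) hne
    have e2 : ∑ i, epAlloc P α w i j * (y i * P i j) =
        (∑ i, (y i * P i j) ^ α * (y i * P i j)) / ∑ i, (y i * P i j) ^ α := by
      rw [Finset.sum_div]
      refine Finset.sum_congr rfl fun i _ => ?_
      rw [ep_alloc_eq P hP α hα.ne' w hw i j]
      ring
    have e3 : ∑ i, X i j * (y i * P i j) ≤ y k * P k j := by
      calc _ ≤ ∑ i, X i j * (y k * P k j) := Finset.sum_le_sum fun i _ =>
            mul_le_mul_of_nonneg_left (hk i (Finset.mem_univ i)) (hX.1 i j).1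
        _ = _ := by rw [← Finset.sum_mul, hX.2 j, one_mul]
    rw [e2]
    refine (mul_le_mul_of_nonneg_left e3 (by linarith)).trans ?_
    rwa [le_div_iff₀ hD]
  rw [h1] at h2
  exact le_of_mul_le_mul_right h2 hT

/-- Minimization: the common ratio is almost at most one. -/
lemma ratio_le {m n : ℕ} (hm : 0 < m) (P : Fin m → Fin n → ℝ)
    (hP : ∀ i j, 0 < P i j) (X : Fin m → Fin n → ℝ) (hX : Feasible X)
    (hl : ∀ i, 0 < loadX P X i) (ε β : ℝ) (hε : 0 < ε) (hβ : 1 ≤ β)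
    (h : m * (1 + ε) ^ (1 - β) ≤ ε) (w : Fin m → ℝ) (hw : ∀ i, 0 < w i) (L : ℝ)
    (hL : epLoad P (-β) w = fun i => L * loadX P X i) : L ≤ 1 + ε := by
  set y : Fin m → ℝ := fun i => w i ^ (-β)⁻¹ with hy
  have hypos : ∀ i, 0 < y i := fun i => Real.rpow_pos_of_pos (hw i) _
  have hne : (Finset.univ : Finset (Fin m)).Nonempty := ⟨⟨0, hm⟩, Finset.mem_univ _⟩
  have hT : 0 < ∑ i, loadX P X i * y i := Finset.sum_pos (fun i _ => mul_pos (hl i) (hypos i)) hne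
  have h1 : ∑ i, epLoad P (-β) w i * y i = L * ∑ i, loadX P X i * y i := by
    rw [hL, Finset.mul_sum]
    exact Finset.sum_congr rfl fun i _ => by ring
  have h2 : ∑ i, epLoad P (-β) w i * y i ≤ (1 + ε) * ∑ i, loadX P X i * y i := by
    have e : ∑ i, epLoad P (-β) w i * y i = ∑ j, ∑ i, epAlloc P (-β) w i j * (y i * P i j) :=
      load_weighted P (epAlloc P (-β) w) y
    rw [e, load_weighted, Finset.mul_sum]
    refine Finset.sum_le_sum fun j _ => ?_
    have hq : ∀ i, 0 < y i * P i j := fun i => mul_pos (hypos i) (hP i j)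
    obtain ⟨k, _, hk⟩ := Finset.exists_min_image Finset.univ (fun i => y i * P i j) hne
    have hav := avg_le ε β hε hβ h (fun i => y i * P i j) hq k
      (fun i => hk i (Finset.mem_univ i))
    have hD : 0 < ∑ i, (y i * P i j) ^ (-β) :=
      Finset.sum_pos (fun i _ => Real.rpow_pos_of_pos (hq i) _) hne
    have e2 : ∑ i, epAlloc P (-β) w i j * (y i * P i j) =
        (∑ i, (y i * P i j) ^ (-β) * (y i * P i j)) / ∑ i, (y i * P i j) ^ (-β) := by
      rw [Finset.sum_div]
      refine Finset.sum_congr rfl fun i _ => ?_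
      rw [ep_alloc_eq P hP (-β) (by linarith : -β < 0).ne w hw i j]
      ring
    have e3 : y k * P k j ≤ ∑ i, X i j * (y i * P i j) := by
      calc y k * P k j = ∑ i, X i j * (y k * P k j) := by
            rw [← Finset.sum_mul, hX.2 j, one_mul]
        _ ≤ _ := Finset.sum_le_sum fun i _ =>
            mul_le_mul_of_nonneg_left (hk i (Finset.mem_univ i)) (hX.1 i j).1
    rw [e2]
    refine le_trans ?_ (mul_le_mul_of_nonneg_left e3 (by linarith))
    rwa [div_le_iff₀ hD]
  rw [h1] at h2
  exact le_of_mul_le_mul_right h2 hT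

lemma exists_exp (m : ℕ) (c ε : ℝ) (hc : 0 < c) (hc1 : c < 1) (hε : 0 < ε) :
    ∃ α : ℝ, 0 < α ∧ m * c ^ α ≤ ε := by
  have h1 : Tendsto (fun α : ℝ => (m : ℝ) * c ^ α) atTop (𝓝 ((m : ℝ) * 0)) :=
    (tendsto_rpow_atTop_of_base_lt_one c (by linarith) hc1).const_mul _
  rw [mul_zero] at h1
  obtain ⟨α, h2, h3⟩ := ((h1.eventually (gt_mem_nhds hε)).and (eventually_gt_atTop 0)).exists
  exact ⟨α, h3, h2.le⟩

theorem stmt19 {m n : ℕ} (hm : 0 < m) (P : Fin m → Fin n → ℝ)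
    (hP : ∀ i j, 0 < P i j)
    (f : (Fin m → ℝ) → ℝ)
    (hfpos : ∀ ℓ : Fin m → ℝ, (∀ i, 0 < ℓ i) → 0 < f ℓ)
    (hmono : ∀ ℓ ℓ' : Fin m → ℝ, (∀ i, 0 < ℓ i) → (∀ i, 0 < ℓ' i) →
      (∀ i, ℓ' i ≤ ℓ i) → f ℓ' ≤ f ℓ)
    (hhom : ∀ c : ℝ, 0 < c → ∀ ℓ : Fin m → ℝ, (∀ i, 0 < ℓ i) →
      f (fun i => c * ℓ i) = c * f ℓ) :
    (∀ Xstar : Fin m → Fin n → ℝ, Feasible Xstar → (∀ i, 0 < loadX P Xstar i) →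
      (∀ X : Fin m → Fin n → ℝ, Feasible X → (∀ i, 0 < loadX P X i) →
        f (loadX P X) ≤ f (loadX P Xstar)) →
      ∀ ε : ℝ, 0 < ε → ∃ (α : ℝ) (w : Fin m → ℝ), (∀ i, 0 < w i) ∧
        (1 - ε) * f (loadX P Xstar) ≤ f (epLoad P α w)) ∧
    (∀ Xstar : Fin m → Fin n → ℝ, Feasible Xstar → (∀ i, 0 < loadX P Xstar i) →
      (∀ X : Fin m → Fin n → ℝ, Feasible X → (∀ i, 0 < loadX P X i) →
        f (loadX P Xstar) ≤ f (loadX P X)) →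
      ∀ ε : ℝ, 0 < ε → ∃ (α : ℝ) (w : Fin m → ℝ), (∀ i, 0 < w i) ∧
        f (epLoad P α w) ≤ (1 + ε) * f (loadX P Xstar)) := by
  have hn : ∀ X : Fin m → Fin n → ℝ, (∀ i, 0 < loadX P X i) → 0 < n := by
    intro X hX
    rcases Nat.eq_zero_or_pos n with h | h
    · subst h
      have := hX ⟨0, hm⟩
      simp [loadX] at this
    · exact h
  refine ⟨fun X hX hl _ ε hε => ?_, fun X hX hl _ ε hε => ?_⟩
  · set δ := min ε (1 / 2) with hδ
    have hδ0 : 0 < δ := lt_min hε (by norm_num)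
    have hδ1 : δ < 1 := (min_le_right _ _).trans_lt (by norm_num)
    obtain ⟨α, hα, h⟩ := exists_exp m (1 - δ) δ (by linarith) (by linarith) hδ0
    obtain ⟨w, L, hw, hLpos, hL⟩ := ep_exists hm (hn X hl) P hP (loadX P X) hl α
    refine ⟨α, w, hw, ?_⟩
    have hr := ratio_ge hm P hP X hX hl δ α hδ0 hδ1 hα h w hw L hL
    rw [hL, hhom L hLpos _ hl]
    have : δ ≤ ε := min_le_left _ _
    exact mul_le_mul_of_nonneg_right (by linarith) (hfpos _ hl).le
  · obtain ⟨γ, hγ, h⟩ := exists_exp m (1 + ε)⁻¹ ε (by positivity)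
      (inv_lt_one_of_one_lt₀ (by linarith)) hε
    obtain ⟨w, L, hw, hLpos, hL⟩ := ep_exists hm (hn X hl) P hP (loadX P X) hl (-(1 + γ))
    refine ⟨-(1 + γ), w, hw, ?_⟩
    have h' : m * (1 + ε) ^ (1 - (1 + γ)) ≤ ε := by
      rw [show 1 - (1 + γ) = -γ by ring, Real.rpow_neg (by linarith),
        ← Real.inv_rpow (by linarith)]
      exact h
    have hr := ratio_le hm P hP X hX hl ε (1 + γ) hε (by linarith) h' w hw L hL
    rw [hL, hhom L hLpos _ hl]
    exact mul_le_mul_of_nonneg_right hr (hfpos _ hl).le
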